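/- Let S be a symmetric numerical semigroup with multiplicity e ≤ 6. Then τ = g(a_1), unless S is the numerical semigroup generated by {5, 6, 9} or the numerical semigroup generated by {6, 7, 10, 11}, in which cases τ < g(a_1). -/

import Mathlib

namespace GotoNS

/-- `S` is a numerical semigroup: an additive submonoid of `ℕ` with finite
complement, different from `ℕ` itself. -/
def IsNumericalSemigroup (S : Set ℕ) : Prop :=
  (0 : ℕ) ∈ S ∧ (∀ a b, a ∈ S → b ∈ S → a + b ∈ S) ∧ Sᶜ.Finite ∧ S ≠ Set.univ

/-- The multiplicity `e` of `S`: its smallest nonzero element. -/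
noncomputable def mult (S : Set ℕ) : ℕ := sInf {n | n ∈ S ∧ n ≠ 0}

/-- The Frobenius number `f` of `S`: the largest integer not in `S`. -/
noncomputable def frob (S : Set ℕ) : ℕ := sSup {n | n ∉ S}

/-- The `k`-fold sumset `kM` of `M = S \ {0}` (with `0M = {0}`). -/
def kfold (S : Set ℕ) (k : ℕ) : Set ℕ :=
  {s | ∃ c : Fin k → ℕ, (∀ i, c i ∈ S ∧ c i ≠ 0) ∧ ∑ i, c i = s}

/-- The order of `s`: the largest `k` such that `s` is a sum of `k` nonzero
elements of `S` (`ord 0 = 0`; junk value `0` off `S`). -/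
noncomputable def ordS (S : Set ℕ) (s : ℕ) : ℕ := sSup {k | s ∈ kfold S k}

/-- The Apéry set `Ap(S; n) = {w ∈ S | w - n ∉ S}`. -/
def apery (S : Set ℕ) (n : ℕ) : Set ℕ := {w | w ∈ S ∧ ∀ s ∈ S, s + n ≠ w}

/-- `σ(α) = max {ord w | w ∈ Ap(S; α)}`. -/
noncomputable def sigmaS (S : Set ℕ) (α : ℕ) : ℕ := sSup (ordS S '' apery S α)

/-- `𝒜(u) = {α ∈ {1, …, e} | u - α ∈ S}`. -/
def Aset (S : Set ℕ) (u : ℕ) : Set ℕ :=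
  {α | 1 ≤ α ∧ α ≤ mult S ∧ ∃ s ∈ S, s + α = u}

/-- The Goto number `g(u) = min {σ(α) | α ∈ 𝒜(u)}`. -/
noncomputable def goto (S : Set ℕ) (u : ℕ) : ℕ := sInf (sigmaS S '' Aset S u)

/-- `τ`: the minimal Goto number of a nonzero element of `S`. -/
noncomputable def tau (S : Set ℕ) : ℕ := sInf (goto S '' {u | u ∈ S ∧ u ≠ 0})

/-- `ρ`: the maximal Goto number of a nonzero element of `S`. -/
noncomputable def rho (S : Set ℕ) : ℕ := sSup (goto S '' {u | u ∈ S ∧ u ≠ 0})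

/-- An integer belongs to `S` (viewed inside `ℤ`). -/
def memZ (S : Set ℕ) (z : ℤ) : Prop := ∃ n : ℕ, n ∈ S ∧ (n : ℤ) = z

/-- `T = {z ∈ ℤ \ S | z + u ∈ S for all 0 ≠ u ∈ S}`. -/
def Tset (S : Set ℕ) : Set ℤ :=
  {z | ¬ memZ S z ∧ ∀ u : ℕ, u ∈ S → u ≠ 0 → memZ S (z + (u : ℤ))}

open Classical in
/-- The order of an integer, with the convention `ord z = -1` if `z ∉ S`. -/
noncomputable def ordZ (S : Set ℕ) (z : ℤ) : ℤ :=
  if 0 ≤ z ∧ z.toNat ∈ S then (ordS S z.toNat : ℤ) else -1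

/-- `S` is symmetric: for integers `x + y = f`, exactly one of `x, y` lies in `S`. -/
def IsSymmetricNS (S : Set ℕ) : Prop :=
  ∀ x y : ℤ, x + y = (frob S : ℤ) → (memZ S x ↔ ¬ memZ S y)

/-- `u ⪯ u'` iff `u' - u ∈ S`. -/
def preceq (S : Set ℕ) (u u' : ℕ) : Prop := ∃ s ∈ S, u + s = u'

/-- `u ⪯_M u'` iff `u + s = u'` and `ord u + ord s = ord u'` for some `s ∈ S`. -/
def preceqM (S : Set ℕ) (u u' : ℕ) : Prop :=
  ∃ s ∈ S, u + s = u' ∧ ordS S u + ordS S s = ordS S u'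

/-- `Ap(S) \ {0}`. -/
def apNZ (S : Set ℕ) : Set ℕ := apery S (mult S) \ {0}

/-- Minimal elements of `Ap(S) \ {0}` with respect to `⪯`. -/
def minAp (S : Set ℕ) : Set ℕ := {w | w ∈ apNZ S ∧ ∀ w' ∈ apNZ S, preceq S w' w → w' = w}

/-- Maximal elements of `Ap(S) \ {0}` with respect to `⪯`. -/
def maxAp (S : Set ℕ) : Set ℕ := {w | w ∈ apNZ S ∧ ∀ w' ∈ apNZ S, preceq S w w' → w' = w}

/-- Minimal elements of `Ap(S) \ {0}` with respect to `⪯_M`. -/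
def minApM (S : Set ℕ) : Set ℕ := {w | w ∈ apNZ S ∧ ∀ w' ∈ apNZ S, preceqM S w' w → w' = w}

/-- Maximal elements of `Ap(S) \ {0}` with respect to `⪯_M`. -/
def maxApM (S : Set ℕ) : Set ℕ := {w | w ∈ apNZ S ∧ ∀ w' ∈ apNZ S, preceqM S w w' → w' = w}

/-- `S` is pure if all elements of `maxAp S` have the same order. -/
def IsPure (S : Set ℕ) : Prop := ∀ w ∈ maxAp S, ∀ w' ∈ maxAp S, ordS S w = ordS S w'

/-- `S` is `M`-pure if all elements of `maxApM S` have the same order. -/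
def IsMPure (S : Set ℕ) : Prop := ∀ w ∈ maxApM S, ∀ w' ∈ maxApM S, ordS S w = ordS S w'

/-- `S` is `M`-additive if `ord (u + a₁) = ord u + 1` for all `u ∈ S`. -/
def IsMAdditive (S : Set ℕ) : Prop := ∀ u ∈ S, ordS S (u + mult S) = ordS S u + 1

/-- The reduction number `r = min {k | (k+1)M = a₁ + kM}`. -/
noncomputable def redNum (S : Set ℕ) : ℕ :=
  sInf {k | kfold S (k + 1) = (fun x => mult S + x) '' kfold S k}

/-- The set of minimal generators of `S`: nonzero elements of `S` that are not
sums of two nonzero elements of `S`. -/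
def minGens (S : Set ℕ) : Set ℕ :=
  {a | a ∈ S ∧ a ≠ 0 ∧ ∀ x ∈ S, ∀ y ∈ S, x ≠ 0 → y ≠ 0 → x + y ≠ a}

/-- `δ_w = max {ord w + ord w' | w' ∈ S, w + w' ∈ Ap(S)}`. -/
noncomputable def deltaI (S : Set ℕ) (w : ℕ) : ℕ :=
  sSup ((fun w' => ordS S w + ordS S w') '' {w' | w' ∈ S ∧ w + w' ∈ apery S (mult S)})

/-- `δ = min {δ_w | w ∈ Ap(S)}`. -/
noncomputable def deltaNS (S : Set ℕ) : ℕ := sInf (deltaI S '' apery S (mult S))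

/-- `γ_w = max {ord w + ⌊w'/a₁⌋ | w' ∈ S, w + w' ∈ Ap(S)}`. -/
noncomputable def gammaI (S : Set ℕ) (w : ℕ) : ℕ :=
  sSup ((fun w' => ordS S w + w' / mult S) '' {w' | w' ∈ S ∧ w + w' ∈ apery S (mult S)})

/-- `γ = min {γ_w | w ∈ Ap(S)}`. -/
noncomputable def gammaNS (S : Set ℕ) : ℕ := sInf (gammaI S '' apery S (mult S))

/-- `ord(C) = min {ord (f+1), …, ord (f+a₁)}`. -/
noncomputable def ordC (S : Set ℕ) : ℕ :=
  sInf ((fun α => ordS S (frob S + α)) '' Set.Icc 1 (mult S))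

theorem IsNumericalSemigroup.zero_mem {S : Set ℕ} (hS : IsNumericalSemigroup S) : 0 ∈ S := hS.1

theorem IsNumericalSemigroup.add_mem {S : Set ℕ} (hS : IsNumericalSemigroup S) {a b : ℕ}
    (ha : a ∈ S) (hb : b ∈ S) : a + b ∈ S := hS.2.1 a b ha hb

theorem IsNumericalSemigroup.mul_mem {S : Set ℕ} (hS : IsNumericalSemigroup S) {a : ℕ}
    (ha : a ∈ S) (k : ℕ) : k * a ∈ S := by
  induction k with
  | zero => simpa using hS.zero_mem
  | succ k ih => rw [Nat.succ_mul]; exact hS.add_mem ih ha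

theorem frob_bddAbove {S : Set ℕ} (hS : IsNumericalSemigroup S) : BddAbove {n | n ∉ S} :=
  Set.Finite.bddAbove hS.2.2.1

theorem frob_notMem {S : Set ℕ} (hS : IsNumericalSemigroup S) : frob S ∉ S := by
  have hne : {n | n ∉ S}.Nonempty := by
    by_contra h
    refine hS.2.2.2 (Set.eq_univ_of_forall fun x => ?_)
    by_contra hx
    exact h ⟨x, hx⟩
  exact Nat.sSup_mem hne (frob_bddAbove hS)

theorem mem_of_frob_lt {S : Set ℕ} (hS : IsNumericalSemigroup S) {n : ℕ} (hn : frob S < n) :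
    n ∈ S := by
  by_contra h
  exact absurd (le_csSup (frob_bddAbove hS) (show n ∈ {n | n ∉ S} from h)) (not_le.2 hn)

theorem mult_mem_ne_zero {S : Set ℕ} (hS : IsNumericalSemigroup S) : mult S ∈ S ∧ mult S ≠ 0 :=
  Nat.sInf_mem (s := {n | n ∈ S ∧ n ≠ 0})
    ⟨frob S + 1, mem_of_frob_lt hS (Nat.lt_succ_self _), Nat.succ_ne_zero _⟩

theorem mult_le {S : Set ℕ} {n : ℕ} (hn : n ∈ S) (h0 : n ≠ 0) : mult S ≤ n :=
  Nat.sInf_le (s := {n | n ∈ S ∧ n ≠ 0}) ⟨hn, h0⟩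

theorem mult_eq {S : Set ℕ} (hS : IsNumericalSemigroup S) {e : ℕ} (he : e ∈ S) (h0 : e ≠ 0)
    (hmin : ∀ n ∈ S, n ≠ 0 → e ≤ n) : mult S = e :=
  le_antisymm (mult_le he h0) (hmin _ (mult_mem_ne_zero hS).1 (mult_mem_ne_zero hS).2)

theorem frob_eq {S : Set ℕ} (hS : IsNumericalSemigroup S) {f : ℕ} (hf : f ∉ S)
    (hmax : ∀ n, f < n → n ∈ S) : frob S = f := by
  refine le_antisymm ?_ (le_csSup (frob_bddAbove hS) hf)
  by_contra h
  exact frob_notMem hS (hmax _ (not_le.1 h))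

theorem mul_mult_le_of_mem_kfold {S : Set ℕ} {k s : ℕ} (h : s ∈ kfold S k) :
    k * mult S ≤ s := by
  obtain ⟨c, hc, rfl⟩ := h
  have := Finset.card_nsmul_le_sum Finset.univ c (mult S)
    fun i _ => mult_le (hc i).1 (hc i).2
  simpa using this

theorem ordS_bddAbove {S : Set ℕ} (hS : IsNumericalSemigroup S) (s : ℕ) :
    BddAbove {k | s ∈ kfold S k} := by
  refine ⟨s, fun k hk => ?_⟩
  have h1 := mul_mult_le_of_mem_kfold hk
  have h2 := Nat.le_mul_of_pos_right k (Nat.pos_of_ne_zero (mult_mem_ne_zero hS).2)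
  omega

theorem le_ordS {S : Set ℕ} (hS : IsNumericalSemigroup S) {k s : ℕ} (h : s ∈ kfold S k) :
    k ≤ ordS S s :=
  le_csSup (ordS_bddAbove hS s) h

theorem zero_mem_kfold (S : Set ℕ) : 0 ∈ kfold S 0 :=
  ⟨Fin.elim0, fun i => i.elim0, by simp⟩

theorem mem_kfold_one {S : Set ℕ} {s : ℕ} (hs : s ∈ S) (h0 : s ≠ 0) : s ∈ kfold S 1 :=
  ⟨fun _ => s, fun _ => ⟨hs, h0⟩, by simp⟩

theorem mem_kfold_ordS {S : Set ℕ} (hS : IsNumericalSemigroup S) {s : ℕ} (hs : s ∈ S) :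
    s ∈ kfold S (ordS S s) := by
  refine Nat.sSup_mem (s := {k | s ∈ kfold S k}) ?_ (ordS_bddAbove hS s)
  by_cases h0 : s = 0
  · exact ⟨0, h0 ▸ zero_mem_kfold S⟩
  · exact ⟨1, mem_kfold_one hs h0⟩

theorem add_mem_kfold {S : Set ℕ} {j k s t : ℕ} (hs : s ∈ kfold S j) (ht : t ∈ kfold S k) :
    s + t ∈ kfold S (j + k) := by
  obtain ⟨c, hc, rfl⟩ := hs
  obtain ⟨d, hd, rfl⟩ := ht
  refine ⟨Fin.append c d, fun i => ?_, by simp [Fin.sum_univ_add]⟩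
  refine Fin.addCases (fun i => ?_) (fun i => ?_) i
  · simpa using hc i
  · simpa using hd i

theorem exists_add_of_mem_kfold_add {S : Set ℕ} {j k s : ℕ} (hs : s ∈ kfold S (j + k)) :
    ∃ u ∈ kfold S j, ∃ v ∈ kfold S k, u + v = s := by
  obtain ⟨c, hc, rfl⟩ := hs
  exact ⟨_, ⟨fun i => c (Fin.castAdd k i), fun i => hc _, rfl⟩,
    _, ⟨fun i => c (Fin.natAdd j i), fun i => hc _, rfl⟩, by rw [Fin.sum_univ_add]⟩

theorem mem_of_mem_kfold {S : Set ℕ} (hS : IsNumericalSemigroup S) {k s : ℕ}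
    (hs : s ∈ kfold S k) : s ∈ S := by
  induction k generalizing s with
  | zero =>
    obtain ⟨c, -, rfl⟩ := hs
    simpa using hS.zero_mem
  | succ k ih =>
    obtain ⟨u, hu, v, ⟨c, hc, rfl⟩, rfl⟩ := exists_add_of_mem_kfold_add hs
    exact hS.add_mem (ih hu) (by simpa using (hc 0).1)

theorem ordS_add_le {S : Set ℕ} (hS : IsNumericalSemigroup S) {s t : ℕ} (hs : s ∈ S)
    (ht : t ∈ S) : ordS S s + ordS S t ≤ ordS S (s + t) :=
  le_ordS hS (add_mem_kfold (mem_kfold_ordS hS hs) (mem_kfold_ordS hS ht))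

theorem one_le_ordS {S : Set ℕ} (hS : IsNumericalSemigroup S) {s : ℕ} (hs : s ∈ S)
    (h0 : s ≠ 0) : 1 ≤ ordS S s :=
  le_ordS hS (mem_kfold_one hs h0)

theorem ordS_mul_mult_le {S : Set ℕ} (hS : IsNumericalSemigroup S) {s : ℕ} (hs : s ∈ S) :
    ordS S s * mult S ≤ s :=
  mul_mult_le_of_mem_kfold (mem_kfold_ordS hS hs)

theorem ordS_zero {S : Set ℕ} (hS : IsNumericalSemigroup S) : ordS S 0 = 0 := by
  have h := ordS_mul_mult_le hS hS.zero_mem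
  have := (mult_mem_ne_zero hS).2
  simpa [this] using h

theorem le_ordS_mul {S : Set ℕ} (hS : IsNumericalSemigroup S) {s : ℕ} (hs : s ∈ S)
    (h0 : s ≠ 0) (k : ℕ) : k ≤ ordS S (k * s) := by
  induction k with
  | zero => exact Nat.zero_le _
  | succ k ih =>
    have h1 := ordS_add_le hS (hS.mul_mem hs k) hs
    have h2 := one_le_ordS hS hs h0
    rw [Nat.succ_mul]
    omega

theorem memZ_natCast {S : Set ℕ} {n : ℕ} : memZ S (n : ℤ) ↔ n ∈ S := by
  constructor
  · rintro ⟨m, hm, h⟩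
    rwa [← Int.natCast_inj.1 h]
  · exact fun h => ⟨n, h, rfl⟩

/-- In a symmetric numerical semigroup every element of `Ap(S; α)` divides `f + α`. -/
theorem exists_add_eq_frob_add {S : Set ℕ} (hsym : IsSymmetricNS S) {w α : ℕ}
    (hw : ∀ s ∈ S, s + α ≠ w) : ∃ v ∈ S, w + v = frob S + α := by
  have h : memZ S ((frob S : ℤ) + α - w) := by
    rw [hsym _ ((w : ℤ) - α) (by ring)]
    rintro ⟨s, hs, h⟩
    exact hw s hs (by omega)
  obtain ⟨v, hv, h⟩ := h
  exact ⟨v, hv, by omega⟩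

theorem sigmaS_eq {S : Set ℕ} (hS : IsNumericalSemigroup S) (hsym : IsSymmetricNS S) {α : ℕ}
    (hα : 1 ≤ α) : sigmaS S α = ordS S (frob S + α) := by
  refine IsGreatest.csSup_eq ⟨⟨_, ⟨mem_of_frob_lt hS (by omega), fun s hs h => ?_⟩, rfl⟩, ?_⟩
  · exact frob_notMem hS (Nat.add_right_cancel h ▸ hs)
  · rintro _ ⟨w, ⟨hw, hw'⟩, rfl⟩
    obtain ⟨v, hv, h⟩ := exists_add_eq_frob_add hsym hw'
    have := ordS_add_le hS hw hv
    rw [h] at this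
    omega

theorem goto_mult {S : Set ℕ} (hS : IsNumericalSemigroup S) (hsym : IsSymmetricNS S) :
    goto S (mult S) = ordS S (frob S + mult S) := by
  have h0 := (mult_mem_ne_zero hS).2
  have : Aset S (mult S) = {mult S} := by
    ext α
    constructor
    · rintro ⟨h1, h2, s, hs, h⟩
      by_cases hs0 : s = 0
      · simpa [hs0] using h
      · have := mult_le hs hs0
        omega
    · rintro rfl
      exact ⟨by omega, le_rfl, 0, hS.zero_mem, by simp⟩
  rw [goto, this, Set.image_singleton, csInf_singleton, sigmaS_eq hS hsym (by omega)]

theorem tau_le {S : Set ℕ} (hS : IsNumericalSemigroup S) (hsym : IsSymmetricNS S) {α : ℕ}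
    (h1 : 1 ≤ α) (h2 : α ≤ mult S) : tau S ≤ ordS S (frob S + α) := by
  have hs : frob S + 1 + α ∈ S := mem_of_frob_lt hS (by omega)
  refine (Nat.sInf_le ⟨_, ⟨hs, by omega⟩, rfl⟩ : tau S ≤ goto S (frob S + 1 + α)).trans ?_
  rw [← sigmaS_eq hS hsym h1]
  exact Nat.sInf_le ⟨α, ⟨h1, h2, _, mem_of_frob_lt hS (Nat.lt_succ_self _), rfl⟩, rfl⟩

theorem Aset_nonempty {S : Set ℕ} (hS : IsNumericalSemigroup S) {u : ℕ} (hu : u ≠ 0) :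
    (Aset S u).Nonempty := by
  obtain ⟨he, h0⟩ := mult_mem_ne_zero hS
  refine ⟨(u - 1) % mult S + 1, by omega, Nat.mod_lt _ (Nat.pos_of_ne_zero h0),
    (u - 1) / mult S * mult S, hS.mul_mem he _, ?_⟩
  have := Nat.div_add_mod' (u - 1) (mult S)
  omega

theorem tau_eq_goto_mult {S : Set ℕ} (hS : IsNumericalSemigroup S) (hsym : IsSymmetricNS S)
    (h : ∀ α, 1 ≤ α → α < mult S → ordS S (frob S + mult S) ≤ ordS S (frob S + α)) :
    tau S = goto S (mult S) := by
  refine IsLeast.csInf_eq ⟨⟨_, mult_mem_ne_zero hS, rfl⟩, ?_⟩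
  rintro _ ⟨u, ⟨-, hu0⟩, rfl⟩
  rw [goto_mult hS hsym]
  obtain ⟨α, ⟨h1, h2, -⟩, hα⟩ := Nat.sInf_mem ((Aset_nonempty hS hu0).image (sigmaS S))
  change _ ≤ sInf _
  rw [← hα, sigmaS_eq hS hsym h1]
  rcases h2.lt_or_eq with h2 | rfl
  · exact h α h1 h2
  · exact le_rfl

/-- Two divisors in `S` of `f + e` that are congruent modulo `e` are equal. -/
theorem eq_of_modEq_mult {S : Set ℕ} (hS : IsNumericalSemigroup S) {u v u' v' : ℕ}
    (hu : u ∈ S) (hv : v ∈ S) (hu' : u' ∈ S) (hv' : v' ∈ S)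
    (huF : u + u' = frob S + mult S) (hvF : v + v' = frob S + mult S)
    (h : u % mult S = v % mult S) : u = v := by
  have key : ∀ u v v', u ∈ S → v' ∈ S → v + v' = frob S + mult S →
      u % mult S = v % mult S → v ≤ u := by
    intro u v v' hu hv' hvF h
    by_contra hlt
    have h1 := Nat.div_add_mod' u (mult S)
    have h2 := Nat.div_add_mod' v (mult S)
    have h3 : u / mult S < v / mult S := by
      by_contra h4
      have := Nat.mul_le_mul_right (mult S) (not_lt.1 h4)
      omega
    obtain ⟨k, hk⟩ := Nat.exists_eq_add_of_lt h3
    have h5 : v = u + k * mult S + mult S := by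
      rw [hk] at h2
      have : (u / mult S + k + 1) * mult S
        = u / mult S * mult S + k * mult S + mult S := by ring
      omega
    refine frob_notMem hS ?_
    have : frob S = u + k * mult S + v' := by omega
    rw [this]
    exact hS.add_mem (hS.add_mem hu (hS.mul_mem (mult_mem_ne_zero hS).1 k)) hv'
  exact le_antisymm (key v u u' hv hu' huF h.symm) (key u v v' hu hv' hvF h)

theorem card_le_mult {S : Set ℕ} (hS : IsNumericalSemigroup S) (T : Finset ℕ)
    (hT : ∀ u ∈ T, u ∈ S ∧ ∃ u' ∈ S, u + u' = frob S + mult S) : T.card ≤ mult S := by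
  have := Finset.card_le_card_of_injOn (s := T) (t := Finset.range (mult S)) (· % mult S)
    (fun u _ => by
      simpa using Nat.mod_lt u (Nat.pos_of_ne_zero (mult_mem_ne_zero hS).2))
    (fun u hu v hv h => by
      obtain ⟨h1, u', h2, h3⟩ := hT u hu
      obtain ⟨h4, v', h5, h6⟩ := hT v hv
      exact eq_of_modEq_mult hS h1 h4 h2 h5 h3 h6 h)
  simpa using this

/-- No seven distinct divisors of `f + e` exist when `e ≤ 6`. -/
theorem not_nodup_seven {S : Set ℕ} (hS : IsNumericalSemigroup S) (he : mult S ≤ 6)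
    {l : List ℕ} (hl : l.length = 7)
    (hT : ∀ u ∈ l, u ∈ S ∧ ∃ u' ∈ S, u + u' = frob S + mult S) : ¬ l.Nodup := by
  intro h
  have h1 := card_le_mult hS l.toFinset (fun u hu => hT u (by simpa using hu))
  rw [List.toFinset_card_of_nodup h] at h1
  omega

/-- An element of order `j + k` is a sum of elements of orders exactly `j` and `k`. -/
theorem exists_split {S : Set ℕ} (hS : IsNumericalSemigroup S) {F j k : ℕ} (hF : F ∈ S)
    (h : ordS S F = j + k) :
    ∃ u ∈ S, ∃ v ∈ S, u + v = F ∧ ordS S u = j ∧ ordS S v = k := by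
  obtain ⟨u, hu, v, hv, rfl⟩ := exists_add_of_mem_kfold_add (h ▸ mem_kfold_ordS hS hF)
  have h1 := mem_of_mem_kfold hS hu
  have h2 := mem_of_mem_kfold hS hv
  have h3 := ordS_add_le hS h1 h2
  have h4 := le_ordS hS hu
  have h5 := le_ordS hS hv
  exact ⟨u, h1, v, h2, rfl, by omega, by omega⟩

/-- When a complementary pair `w, w'` in `Ap(S)` has too small total order, `f + e` has order `3`
and is three times a generator, while `w` and `w'` are generators. -/
theorem eq_three_mul_of_ordS_add_lt {S : Set ℕ} (hS : IsNumericalSemigroup S)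
    (he : mult S ≤ 6) {w w' : ℕ} (hw : w ∈ S) (hw' : w' ∈ S) (h0 : w ≠ 0) (h0' : w' ≠ 0)
    (hF : w + w' = frob S + mult S)
    (hlt : ordS S w + ordS S w' < ordS S (frob S + mult S)) :
    ordS S (frob S + mult S) = 3 ∧ ordS S w = 1 ∧ ordS S w' = 1 ∧
      ∃ a ∈ S, a ≠ 0 ∧ 3 * a = frob S + mult S ∧ ordS S a = 1 ∧ 2 ≤ ordS S (2 * a) := by
  have hFS : frob S + mult S ∈ S := hF ▸ hS.add_mem hw hw'
  have hz := ordS_zero hS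
  have p1 := one_le_ordS hS hw h0
  have p2 := one_le_ordS hS hw' h0'
  generalize hFdef : frob S + mult S = F at *
  have hwne : ∀ {u v}, u + v = F → ordS S u + ordS S v = ordS S F → u ≠ w := by
    rintro u v huv ho rfl
    have : v = w' := by omega
    subst this
    omega
  have hz1 : (0 : ℕ) ∈ S ∧ ∃ u' ∈ S, 0 + u' = F := ⟨hS.zero_mem, F, hFS, by simp⟩
  have hF1 : F ∈ S ∧ ∃ u' ∈ S, F + u' = F := ⟨hFS, 0, hS.zero_mem, by simp⟩
  have hw1 : w ∈ S ∧ ∃ u' ∈ S, w + u' = F := ⟨hw, w', hw', hF⟩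
  have hord : ∀ {x y : ℕ}, ordS S x ≠ ordS S y → x ≠ y := fun h h' => h (h' ▸ rfl)
  have hwF : w ≠ F := by omega
  have seven : ∀ {l : List ℕ}, l.length = 7 →
      (∀ u ∈ l, u ∈ S ∧ ∃ u' ∈ S, u + u' = F) → ¬ l.Nodup := fun hl hT =>
    not_nodup_seven hS he hl (by rwa [hFdef])
  rcases Nat.lt_or_ge 4 (ordS S F) with hr | hr
  · exfalso
    obtain ⟨r, hr⟩ : ∃ r, ordS S F = r + 5 := ⟨ordS S F - 5, by omega⟩
    obtain ⟨u₁, a1, v₁, b1, c1, d1, e1⟩ := exists_split hS (j := 1) (k := r + 4) hFS (by omega)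
    obtain ⟨u₂, a2, v₂, b2, c2, d2, e2⟩ := exists_split hS (j := 2) (k := r + 3) hFS (by omega)
    obtain ⟨u₃, a3, v₃, b3, c3, d3, e3⟩ := exists_split hS (j := 3) (k := r + 2) hFS (by omega)
    obtain ⟨u₄, a4, v₄, b4, c4, d4, e4⟩ := exists_split hS (j := 4) (k := r + 1) hFS (by omega)
    have n1 := hwne c1 (by omega)
    have n2 := hwne c2 (by omega)
    have n3 := hwne c3 (by omega)
    have n4 := hwne c4 (by omega)
    refine seven (l := [0, u₁, u₂, u₃, u₄, F, w]) rfl ?_ ?_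
    · simp only [List.forall_mem_cons]
      exact ⟨hz1, ⟨a1, _, b1, c1⟩, ⟨a2, _, b2, c2⟩, ⟨a3, _, b3, c3⟩, ⟨a4, _, b4, c4⟩, hF1, hw1,
        by simp⟩
    · simp only [List.nodup_cons, List.mem_cons, List.not_mem_nil, or_false, not_or,
        not_false_eq_true, List.nodup_nil, and_true]
      refine ⟨⟨?_, ?_, ?_, ?_, ?_, h0.symm⟩, ⟨?_, ?_, ?_, ?_, n1⟩, ⟨?_, ?_, ?_, n2⟩,
        ⟨?_, ?_, n3⟩, ⟨?_, n4⟩, hwF.symm⟩ <;> exact hord (by omega)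
  rcases Nat.lt_or_ge 3 (ordS S F) with hr' | hr'
  · exfalso
    obtain ⟨u₁, a1, v₁, b1, c1, d1, e1⟩ := exists_split hS (j := 1) (k := 3) hFS (by omega)
    obtain ⟨u₂, a2, v₂, b2, c2, d2, e2⟩ := exists_split hS (j := 2) (k := 2) hFS (by omega)
    have n1 := hwne c1 (by omega)
    have n1' := hwne ((add_comm _ _).trans c1) (by omega)
    have n2 := hwne c2 (by omega)
    have n2' := hwne ((add_comm _ _).trans c2) (by omega)
    rcases eq_or_ne u₂ v₂ with n2n | n2n
    · have n3 : w ≠ w' := by omega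
      have m1' : u₁ ≠ w' := by omega
      have m2' : u₂ ≠ w' := by omega
      have m3' : v₁ ≠ w' := by omega
      refine seven (l := [0, u₁, u₂, v₁, F, w, w']) rfl ?_ ?_
      · simp only [List.forall_mem_cons]
        exact ⟨hz1, ⟨a1, _, b1, c1⟩, ⟨a2, _, b2, c2⟩, ⟨b1, _, a1, (add_comm _ _).trans c1⟩, hF1,
          hw1, ⟨hw', _, hw, (add_comm _ _).trans hF⟩, by simp⟩
      · simp only [List.nodup_cons, List.mem_cons, List.not_mem_nil, or_false, not_or,
          not_false_eq_true, List.nodup_nil, and_true]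
        refine ⟨⟨?_, ?_, ?_, ?_, h0.symm, h0'.symm⟩, ⟨?_, ?_, ?_, n1, m1'⟩, ⟨?_, ?_, n2, m2'⟩,
          ⟨?_, n1', m3'⟩, ⟨hwF.symm, by omega⟩, n3⟩ <;> exact hord (by omega)
    · refine seven (l := [0, u₁, u₂, v₂, v₁, F, w]) rfl ?_ ?_
      · simp only [List.forall_mem_cons]
        exact ⟨hz1, ⟨a1, _, b1, c1⟩, ⟨a2, _, b2, c2⟩, ⟨b2, _, a2, (add_comm _ _).trans c2⟩,
          ⟨b1, _, a1, (add_comm _ _).trans c1⟩, hF1, hw1, by simp⟩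
      · simp only [List.nodup_cons, List.mem_cons, List.not_mem_nil, or_false, not_or,
          not_false_eq_true, List.nodup_nil, and_true]
        refine ⟨⟨?_, ?_, ?_, ?_, ?_, h0.symm⟩, ⟨?_, ?_, ?_, ?_, n1⟩, ⟨n2n, ?_, ?_, n2⟩,
          ⟨?_, ?_, n2'⟩, ⟨?_, n1'⟩, hwF.symm⟩ <;> exact hord (by omega)
  have hr3 : ordS S F = 3 := by omega
  obtain ⟨a, ha, v, hv, c1, d1, e1⟩ := exists_split hS (j := 1) (k := 2) hFS hr3
  obtain ⟨b, hb, c, hc, rfl, d2, e2⟩ := exists_split hS (j := 1) (k := 1) hv e1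
  have pair : ∀ {a b c}, a ∈ S → b ∈ S → c ∈ S → a + (b + c) = F → ordS S a = 1 →
      ordS S b = 1 → ordS S c = 1 → a = b := by
    intro a b c ha hb hc h oa ob oc
    by_contra hab
    have hac := hS.add_mem ha hc
    have hbc := hS.add_mem hb hc
    have q0 := ordS_add_le hS ha hc
    have q1 := ordS_add_le hS hb hc
    have q2 := ordS_add_le hS ha hbc
    have q3 := ordS_add_le hS hb hac
    have h' : b + (a + c) = F := by omega
    rw [h] at q2
    rw [h'] at q3
    have n1 := hwne h (by omega)
    have n1' := hwne ((add_comm _ _).trans h) (by omega)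
    have n2 := hwne h' (by omega)
    have n2' := hwne ((add_comm _ _).trans h') (by omega)
    refine seven (l := [0, a, b, b + c, a + c, F, w]) rfl ?_ ?_
    · simp only [List.forall_mem_cons]
      exact ⟨hz1, ⟨ha, _, hbc, h⟩, ⟨hb, _, hac, h'⟩, ⟨hbc, _, ha, (add_comm _ _).trans h⟩,
        ⟨hac, _, hb, (add_comm _ _).trans h'⟩, hF1, hw1, by simp⟩
    · simp only [List.nodup_cons, List.mem_cons, List.not_mem_nil, or_false, not_or,
        not_false_eq_true, List.nodup_nil, and_true]
      refine ⟨⟨?_, ?_, ?_, ?_, ?_, h0.symm⟩, ⟨hab, ?_, ?_, ?_, n1⟩, ⟨?_, ?_, ?_, n2⟩,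
        ⟨by omega, ?_, n1'⟩, ⟨?_, n2'⟩, hwF.symm⟩ <;> exact hord (by omega)
  have hab := pair ha hb hc c1 d1 d2 e2
  have hac := pair ha hc hb (by omega) d1 e2 d2
  subst hab hac
  exact ⟨hr3, by omega, by omega, a, ha, by rintro rfl; omega, by omega, d1, by
    rw [two_mul]; omega⟩

theorem eq_seven_of_residues_mod_six {a w w' : ℕ} (ha : 6 ≤ a) (hw' : 6 ≤ w') (hlt : w' < 2 * 6)
    (hsum : w + w' = 3 * a) (q1 : ¬ 0 % 6 = w % 6)
    (q1' : ¬ 0 % 6 = w' % 6) (q2 : ¬ 0 % 6 = 2 * a % 6) (q3 : ¬ 3 * a % 6 = 0 % 6)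
    (q4 : ¬ a % 6 = w' % 6) (q5 : ¬ 2 * a % 6 = w' % 6)
    (d2a : 2 * w' % 6 = 2 * a % 6 → 2 * a ≤ 2 * w') (dw : 2 * w' % 6 = w % 6 → w ≤ 2 * w') :
    a = 7 ∧ (w' = 10 ∧ w = 11 ∨ w' = 11 ∧ w = 10) := by
  have ha6 : a % 6 = 1 ∨ a % 6 = 5 := by
    clear q1 q1' q4 q5 d2a dw
    omega
  clear q2 q3
  have hc : w' = 6 ∨ w' = 7 ∨ w' = 8 ∨ w' = 9 ∨ w' = 10 ∨ w' = 11 := by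
    clear q1 q1' q4 q5 d2a dw
    omega
  rcases ha6 with h | h <;> rcases hc with rfl | rfl | rfl | rfl | rfl | rfl <;>
    first
      | (clear d2a dw; omega)
      | (have := d2a (by omega); omega)
      | (have := dw (by omega); omega)

/-- A complementary pair of too small total order with `w' < 2e` determines `S`. -/
theorem frob_eq_of_ordS_add_lt {S : Set ℕ} (hS : IsNumericalSemigroup S)
    (he : mult S ≤ 6) {w w' : ℕ} (hw : w ∈ S) (hw' : w' ∈ S) (h0 : w ≠ 0) (h0' : w' ≠ 0)
    (hF : w + w' = frob S + mult S)
    (hlt : ordS S w + ordS S w' < ordS S (frob S + mult S)) (hlt' : w' < 2 * mult S) :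
    (mult S = 5 ∧ frob S = 13 ∧ 6 ∈ S ∧ 9 ∈ S) ∨
      (mult S = 6 ∧ frob S = 15 ∧ 7 ∈ S ∧ 10 ∈ S ∧ 11 ∈ S) := by
  obtain ⟨hr, ow, ow', a, ha, ha0, h3a, oa, o2a⟩ :=
    eq_three_mul_of_ordS_add_lt hS he hw hw' h0 h0' hF hlt
  have h2a : 2 * a ∈ S := hS.mul_mem ha 2
  have h2w' : 2 * w' ∈ S := hS.mul_mem hw' 2
  have hFS : frob S + mult S ∈ S := hF ▸ hS.add_mem hw hw'
  have hz := ordS_zero hS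
  have hord : ∀ {x y : ℕ}, ordS S x ≠ ordS S y → x ≠ y := fun h h' => h (h' ▸ rfl)
  have n1 : w ≠ a := by
    rintro rfl
    exact hord (x := w') (y := 2 * w) (by omega) (by omega)
  have n1' : w' ≠ a := by
    rintro rfl
    exact hord (x := w) (y := 2 * w') (by omega) (by omega)
  have n2 : w ≠ 2 * a := hord (by omega)
  have n2' : w' ≠ 2 * a := hord (by omega)
  have hwe := mult_le hw h0
  have hwe' := mult_le hw' h0'
  have hae := mult_le ha ha0
  have q0 := mt (eq_of_modEq_mult hS hS.zero_mem ha hFS h2a (by omega) (by omega)) ha0.symm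
  have q1 := mt (eq_of_modEq_mult hS hS.zero_mem hw hFS hw' (by omega) (by omega)) h0.symm
  have q1' := mt (eq_of_modEq_mult hS hS.zero_mem hw' hFS hw (by omega) (by omega)) h0'.symm
  have q2 := mt (eq_of_modEq_mult hS hS.zero_mem h2a hFS ha (by omega) (by omega)) (by omega)
  have q3 := mt (eq_of_modEq_mult hS hFS hS.zero_mem hS.zero_mem hFS (by omega) (by omega))
    (by omega)
  rw [← h3a] at q3
  have q4 := mt (eq_of_modEq_mult hS ha hw h2a hw' (by omega) (by omega)) n1.symm
  have q4' := mt (eq_of_modEq_mult hS ha hw' h2a hw (by omega) (by omega)) n1'.symm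
  have q5 := mt (eq_of_modEq_mult hS h2a hw ha hw' (by omega) (by omega)) n2.symm
  have q5' := mt (eq_of_modEq_mult hS h2a hw' ha hw (by omega) (by omega)) n2'.symm
  have card : 5 + (if w = w' then 0 else 1) ≤ mult S := by
    have hsub : ∀ u ∈ ({0, a, 2 * a, 3 * a, w, w'} : Finset ℕ),
        u ∈ S ∧ ∃ u' ∈ S, u + u' = frob S + mult S := by
      simp only [Finset.mem_insert, Finset.mem_singleton]
      rintro u (rfl | rfl | rfl | rfl | rfl | rfl)
      · exact ⟨hS.zero_mem, _, hFS, by omega⟩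
      · exact ⟨ha, _, h2a, by omega⟩
      · exact ⟨h2a, _, ha, by omega⟩
      · exact ⟨h3a ▸ hFS, _, hS.zero_mem, by omega⟩
      · exact ⟨hw, _, hw', hF⟩
      · exact ⟨hw', _, hw, by omega⟩
    have := card_le_mult hS _ hsub
    refine le_trans ?_ this
    have m1 : 0 ∉ ({a, 2 * a, 3 * a, w, w'} : Finset ℕ) := by simp; omega
    have m2 : a ∉ ({2 * a, 3 * a, w, w'} : Finset ℕ) := by simp; omega
    have m3 : 2 * a ∉ ({3 * a, w, w'} : Finset ℕ) := by simp; omega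
    have m4 : 3 * a ∉ ({w, w'} : Finset ℕ) := by simp; omega
    rw [Finset.card_insert_of_notMem m1, Finset.card_insert_of_notMem m2,
      Finset.card_insert_of_notMem m3, Finset.card_insert_of_notMem m4]
    split_ifs with h
    · simp [h]
    · rw [Finset.card_pair h]
  split_ifs at card with hww
  · left
    subst hww
    have h5 : mult S = 5 := by
      by_contra h5
      have h6 : mult S = 6 := by omega
      rw [h6] at q0 hae hlt'
      omega
    have : w = 9 := by omega
    have : a = 6 := by omega
    subst_vars
    exact ⟨h5, by omega, ha, hw⟩
  · right
    have h6 : mult S = 6 := by omega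
    have d2a : 2 * w' % 6 = 2 * a % 6 → 2 * a ≤ 2 * w' := by
      intro h
      by_contra hc
      obtain ⟨k, hk⟩ : ∃ k, 2 * w' + k * 6 + 6 = 2 * a := ⟨(2 * a - 2 * w') / 6 - 1, by omega⟩
      refine frob_notMem hS ?_
      rw [show frob S = 2 * w' + k * mult S + a by rw [h6]; omega]
      exact hS.add_mem (hS.add_mem h2w' (hS.mul_mem (mult_mem_ne_zero hS).1 k)) ha
    have dw : 2 * w' % 6 = w % 6 → w ≤ 2 * w' := by
      intro h
      by_contra hc
      obtain ⟨k, hk⟩ : ∃ k, 2 * w' + k * 6 + 6 = w := ⟨(w - 2 * w') / 6 - 1, by omega⟩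
      refine frob_notMem hS ?_
      rw [show frob S = 2 * w' + k * mult S + w' by rw [h6]; omega]
      exact hS.add_mem (hS.add_mem h2w' (hS.mul_mem (mult_mem_ne_zero hS).1 k)) hw'
    rw [h6] at q1 q1' q2 q3 q4 q4' q5 q5' hlt' hwe hwe' hae
    have hcase := eq_seven_of_residues_mod_six hae hwe' hlt' (by omega : w + w' = 3 * a) q1 q1' q2 q3 q4'
      q5' d2a dw
    obtain ⟨rfl, ⟨rfl, rfl⟩ | ⟨rfl, rfl⟩⟩ := hcase
    · exact ⟨h6, by omega, ha, hw', hw⟩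
    · exact ⟨h6, by omega, ha, hw, hw'⟩

theorem eq_of_frob_eq {S T : Set ℕ} (hS : IsNumericalSemigroup S)
    (hTS : T ⊆ S) (hT : ∀ n, n ∉ T → n ≤ frob S ∧ frob S - n ∈ T) : S = T := by
  refine Set.Subset.antisymm (fun x hx => ?_) hTS
  by_contra hxT
  obtain ⟨hle, hmem⟩ := hT x hxT
  refine frob_notMem hS ?_
  rw [← Nat.add_sub_cancel' hle]
  exact hS.add_mem hx (hTS hmem)

theorem mem_closure_five_six_nine {n : ℕ} :
    n ∈ (AddSubmonoid.closure ({5, 6, 9} : Set ℕ) : Set ℕ) ↔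
      n = 0 ∨ n = 5 ∨ n = 6 ∨ n = 9 ∨ n = 10 ∨ n = 11 ∨ n = 12 ∨ 14 ≤ n := by
  rw [SetLike.mem_coe]
  constructor
  · intro h
    induction h using AddSubmonoid.closure_induction with
    | mem x hx => simp at hx; omega
    | zero => omega
    | add x y _ _ hx hy => omega
  · intro h
    obtain ⟨a, b, c, rfl⟩ : ∃ a b c : ℕ, n = a • 5 + b • 6 + c • 9 := by
      simp only [smul_eq_mul]
      have : n % 5 = 0 ∨ n % 5 = 1 ∨ n % 5 = 2 ∨ n % 5 = 3 ∨ n % 5 = 4 := by omega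
      rcases this with h' | h' | h' | h' | h'
      · exact ⟨n / 5, 0, 0, by omega⟩
      · exact ⟨(n - 6) / 5, 1, 0, by omega⟩
      · exact ⟨(n - 12) / 5, 2, 0, by omega⟩
      · exact ⟨(n - 18) / 5, 3, 0, by omega⟩
      · exact ⟨(n - 9) / 5, 0, 1, by omega⟩
    exact add_mem (add_mem (nsmul_mem (AddSubmonoid.subset_closure (by simp)) _)
      (nsmul_mem (AddSubmonoid.subset_closure (by simp)) _))
      (nsmul_mem (AddSubmonoid.subset_closure (by simp)) _)

theorem mem_closure_six_seven_ten_eleven {n : ℕ} :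
    n ∈ (AddSubmonoid.closure ({6, 7, 10, 11} : Set ℕ) : Set ℕ) ↔
      n = 0 ∨ n = 6 ∨ n = 7 ∨ (10 ≤ n ∧ n ≤ 14) ∨ 16 ≤ n := by
  rw [SetLike.mem_coe]
  constructor
  · intro h
    induction h using AddSubmonoid.closure_induction with
    | mem x hx => simp at hx; omega
    | zero => omega
    | add x y _ _ hx hy => omega
  · intro h
    obtain ⟨a, b, c, d, rfl⟩ : ∃ a b c d : ℕ, n = a • 6 + b • 7 + c • 10 + d • 11 := by
      simp only [smul_eq_mul]
      have : n % 6 = 0 ∨ n % 6 = 1 ∨ n % 6 = 2 ∨ n % 6 = 3 ∨ n % 6 = 4 ∨ n % 6 = 5 := by omega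
      rcases this with h' | h' | h' | h' | h' | h'
      · exact ⟨n / 6, 0, 0, 0, by omega⟩
      · exact ⟨(n - 7) / 6, 1, 0, 0, by omega⟩
      · exact ⟨(n - 14) / 6, 2, 0, 0, by omega⟩
      · exact ⟨(n - 21) / 6, 3, 0, 0, by omega⟩
      · exact ⟨(n - 10) / 6, 0, 1, 0, by omega⟩
      · exact ⟨(n - 11) / 6, 0, 0, 1, by omega⟩
    exact add_mem (add_mem (add_mem (nsmul_mem (AddSubmonoid.subset_closure (by simp)) _)
      (nsmul_mem (AddSubmonoid.subset_closure (by simp)) _))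
      (nsmul_mem (AddSubmonoid.subset_closure (by simp)) _))
      (nsmul_mem (AddSubmonoid.subset_closure (by simp)) _)

theorem tau_lt_goto_mult {S : Set ℕ} (hS : IsNumericalSemigroup S) (hsym : IsSymmetricNS S)
    {a α : ℕ} (h1 : 1 ≤ α) (h2 : α ≤ mult S) (ha : a ∈ S) (ha0 : a ≠ 0)
    (h3 : frob S + mult S = 3 * a) (hlt : frob S + α < 3 * mult S) :
    tau S < goto S (mult S) := by
  rw [goto_mult hS hsym, h3]
  have k1 := le_ordS_mul hS ha ha0 3
  have k2 := tau_le hS hsym h1 h2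
  have k3 := ordS_mul_mult_le hS (mem_of_frob_lt hS (show frob S < frob S + α by omega))
  have k4 : ordS S (frob S + α) < 3 := Nat.lt_of_mul_lt_mul_right (k3.trans_lt hlt)
  omega

/-- Every `f + α` with `1 ≤ α < e` is `w + k e` with `w` in the Apéry set of `e`. -/
theorem exists_apery_add_mul {S : Set ℕ} (hS : IsNumericalSemigroup S) (hsym : IsSymmetricNS S)
    {n : ℕ} (hn : n ∈ S) :
    ∃ w ∈ S, ∃ k, w + k * mult S = n ∧ ∃ w' ∈ S, w + w' = frob S + mult S := by
  induction n using Nat.strong_induction_on with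
  | _ n ih =>
    by_cases h : ∃ s ∈ S, s + mult S = n
    · obtain ⟨s, hs, rfl⟩ := h
      have := (mult_mem_ne_zero hS).2
      obtain ⟨w, hw, k, hk, hw'⟩ := ih s (by omega) hs
      exact ⟨w, hw, k + 1, by rw [Nat.succ_mul]; omega, hw'⟩
    · push Not at h
      exact ⟨n, hn, 0, by simp, exists_add_eq_frob_add hsym h⟩

/-- for symmetric `S` with `e ≤ 6`, `τ = g(a₁)` except for
`⟨5,6,9⟩` and `⟨6,7,10,11⟩`, where `τ < g(a₁)`. -/
theorem statement17 (S : Set ℕ) (hS : IsNumericalSemigroup S) (hsym : IsSymmetricNS S)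
    (he : mult S ≤ 6) :
    ((S ≠ (AddSubmonoid.closure ({5, 6, 9} : Set ℕ) : Set ℕ) ∧
      S ≠ (AddSubmonoid.closure ({6, 7, 10, 11} : Set ℕ) : Set ℕ)) →
        tau S = goto S (mult S)) ∧
    ((S = (AddSubmonoid.closure ({5, 6, 9} : Set ℕ) : Set ℕ) ∨
      S = (AddSubmonoid.closure ({6, 7, 10, 11} : Set ℕ) : Set ℕ)) →
        tau S < goto S (mult S)) := by
  constructor
  · rintro ⟨hA, hB⟩
    refine tau_eq_goto_mult hS hsym fun α h1 h2 => ?_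
    obtain ⟨w, hw, k, hk, w', hw', hF⟩ :=
      exists_apery_add_mul hS hsym (mem_of_frob_lt hS (show frob S < frob S + α by omega))
    obtain ⟨hes, he0⟩ := mult_mem_ne_zero hS
    have h0' : w' ≠ 0 := by
      rintro rfl
      omega
    have hk1 : k ≤ ordS S (k * mult S) := le_ordS_mul hS hes he0 k
    have hsum := ordS_add_le hS hw (hS.mul_mem hes k)
    rw [hk] at hsum
    have hkw : ∀ j, j * mult S ≤ w' → j ≤ k := by
      intro j hj
      have : j * mult S < (k + 1) * mult S := by
        rw [Nat.succ_mul]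
        omega
      exact Nat.lt_succ_iff.1 (Nat.lt_of_mul_lt_mul_right this)
    have hkw' := hkw _ (ordS_mul_mult_le hS hw')
    by_cases hlt : ordS S (frob S + mult S) ≤ ordS S w + ordS S w'
    · omega
    rw [not_le] at hlt
    have h0 : w ≠ 0 := by
      rintro rfl
      rw [zero_add] at hF
      rw [hF] at hlt
      omega
    rcases Nat.lt_or_ge w' (2 * mult S) with hlt' | hge
    · exfalso
      rcases frob_eq_of_ordS_add_lt hS he hw hw' h0 h0' hF hlt hlt' with
        ⟨h5, hf, h6, h9⟩ | ⟨h6, hf, h7, h10, h11⟩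
      · refine hA (eq_of_frob_eq hS ?_ ?_)
        · intro x hx
          have hle : AddSubmonoid.closure ({5, 6, 9} : Set ℕ) ≤
              { carrier := S, zero_mem' := hS.zero_mem, add_mem' := hS.add_mem } := by
            rw [AddSubmonoid.closure_le]
            rintro x (rfl | rfl | rfl)
            exacts [h5 ▸ hes, h6, h9]
          exact hle hx
        · intro n hn
          rw [mem_closure_five_six_nine] at hn ⊢
          omega
      · refine hB (eq_of_frob_eq hS ?_ ?_)
        · intro x hx
          have hle : AddSubmonoid.closure ({6, 7, 10, 11} : Set ℕ) ≤
              { carrier := S, zero_mem' := hS.zero_mem, add_mem' := hS.add_mem } := by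
            rw [AddSubmonoid.closure_le]
            rintro x (rfl | rfl | rfl | rfl)
            exacts [h6 ▸ hes, h7, h10, h11]
          exact hle hx
        · intro n hn
          rw [mem_closure_six_seven_ten_eleven] at hn ⊢
          omega
    · have hr := (eq_three_mul_of_ordS_add_lt hS he hw hw' h0 h0' hF hlt).1
      have := hkw 2 hge
      have := one_le_ordS hS hw h0
      omega
  · rintro (h | h)
    · have hmem : ∀ n, n ∈ S ↔ _ := fun n => h ▸ mem_closure_five_six_nine (n := n)
      have hm : mult S = 5 := mult_eq hS (by rw [hmem]; omega) (by omega)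
        fun n hn h0 => by rw [hmem] at hn; omega
      have hf : frob S = 13 := frob_eq hS (by rw [hmem]; omega) fun n hn => by rw [hmem]; omega
      exact tau_lt_goto_mult hS hsym (a := 6) (α := 1) le_rfl (by omega) (by rw [hmem]; omega)
        (by omega) (by omega) (by omega)
    · have hmem : ∀ n, n ∈ S ↔ _ := fun n => h ▸ mem_closure_six_seven_ten_eleven (n := n)
      have hm : mult S = 6 := mult_eq hS (by rw [hmem]; omega) (by omega)
        fun n hn h0 => by rw [hmem] at hn; omega
      have hf : frob S = 15 := frob_eq hS (by rw [hmem]; omega) fun n hn => by rw [hmem]; omega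
      exact tau_lt_goto_mult hS hsym (a := 7) (α := 2) (by omega) (by omega)
        (by rw [hmem]; omega) (by omega) (by omega) (by omega)

end GotoNS
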